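/- Let B be a finite subset of F and let f₁, f₂ ∈ F with f₁ ∉ B and f₂ ∉ B (two epistemic inputs). Suppose that for every X ⊆ B, the set X ∪ {f₁} is inconsistent if and only if X ∪ {f₂} is inconsistent. Then { M \ {f₁} | M a maximal consistent subset of B ∪ {f₁} } = { M \ {f₂} | M a maximal consistent subset of B ∪ {f₂} }; that is, the candidate replacement programs determined by the two inputs, with the respective input removed, coincide. -/

import Mathlib

/-- An inconsistency predicate is upward closed. -/
def UpClosed {F : Type*} (Incons : Finset F → Prop) : Prop :=
  ∀ X Y : Finset F, X ⊆ Y → Incons X → Incons Y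

/-- `M` is a maximal consistent subset of `X`. -/
def MaxCons {F : Type*} (Incons : Finset F → Prop) (X M : Finset F) : Prop :=
  M ⊆ X ∧ ¬ Incons M ∧ ∀ M' : Finset F, M ⊂ M' → M' ⊆ X → Incons M'

/-- If `f` and `g` cause the same inconsistencies over `B`, then every maximal consistent subset of
`insert f B` agrees, up to the two inputs, with a maximal consistent subset of `insert g B`. -/
theorem MaxCons.exists_erase_eq {F : Type*} [DecidableEq F] {Incons : Finset F → Prop}
    (hup : UpClosed Incons) {B : Finset F} {f g : F} (hf : f ∉ B) (hg : g ∉ B)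
    (h : ∀ X ⊆ B, (Incons (insert f X) ↔ Incons (insert g X))) {M : Finset F}
    (hM : MaxCons Incons (insert f B) M) :
    ∃ N : Finset F, MaxCons Incons (insert g B) N ∧ M.erase f = N.erase g := by
  obtain ⟨hMB, hcons, hmax⟩ := hM
  by_cases hfM : f ∈ M
  · have hXB : M.erase f ⊆ B := Finset.subset_insert_iff.mp hMB
    have hgX : g ∉ M.erase f := fun hgX => hg (hXB hgX)
    refine ⟨insert g (M.erase f), ⟨Finset.insert_subset_insert g hXB, ?_, ?_⟩,
      (Finset.erase_insert hgX).symm⟩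
    · rwa [← h _ hXB, Finset.insert_erase hfM]
    · intro N hMN hNB
      have hgN : g ∈ N := hMN.subset (Finset.mem_insert_self _ _)
      have hNB' : N.erase g ⊆ B := Finset.subset_insert_iff.mp hNB
      rw [← Finset.insert_erase hgN, ← h _ hNB']
      refine hmax _ ?_ (Finset.insert_subset_insert f hNB')
      obtain ⟨x, hxN, hxM⟩ := Finset.exists_of_ssubset hMN
      have hsub := hMN.subset
      refine (Finset.ssubset_iff_of_subset ?_).mpr ⟨x, ?_, ?_⟩ <;> grind
  · have hMB' : M ⊆ B := (Finset.subset_insert_iff_of_notMem hfM).mp hMB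
    have hgM : g ∉ M := fun hgM => hg (hMB' hgM)
    refine ⟨M, ⟨hMB'.trans (Finset.subset_insert g B), hcons, ?_⟩, ?_⟩
    · intro N hMN hNB
      by_cases hgN : g ∈ N
      · have hinc : Incons (insert g M) :=
          (h M hMB').mp (hmax _ (Finset.ssubset_insert hfM) (Finset.insert_subset_insert f hMB'))
        exact hup _ _ (Finset.insert_subset hgN hMN.subset) hinc
      · exact hmax N hMN (((Finset.subset_insert_iff_of_notMem hgN).mp hNB).trans
          (Finset.subset_insert f B))
    · rw [Finset.erase_eq_of_notMem hfM, Finset.erase_eq_of_notMem hgM]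

/-- if two epistemic inputs `f₁, f₂ ∉ B` cause inconsistencies in the same
way (for every `X ⊆ B`, `X ∪ {f₁}` is inconsistent iff `X ∪ {f₂}` is inconsistent), then
the candidate replacement programs with the respective input removed coincide. -/
theorem stmt7 {F : Type*} [DecidableEq F] (Incons : Finset F → Prop)
    (hup : UpClosed Incons) (B : Finset F) (f₁ f₂ : F)
    (hf₁ : f₁ ∉ B) (hf₂ : f₂ ∉ B)
    (h : ∀ X ⊆ B, (Incons (insert f₁ X) ↔ Incons (insert f₂ X))) :
    {Y : Finset F | ∃ M : Finset F, MaxCons Incons (insert f₁ B) M ∧ Y = M.erase f₁} =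
    {Y : Finset F | ∃ M : Finset F, MaxCons Incons (insert f₂ B) M ∧ Y = M.erase f₂} := by
  ext Y
  constructor
  · rintro ⟨M, hM, rfl⟩
    exact hM.exists_erase_eq hup hf₁ hf₂ h
  · rintro ⟨M, hM, rfl⟩
    exact hM.exists_erase_eq hup hf₂ hf₁ fun X hX => (h X hX).symm
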